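/- arXiv:1904.03068 — 4 statements merged into one kernel-verified Lean document; each statement's English description precedes it below -/
import Mathlib

section
/- Let m ≥ 0 be an integer and let z_0, z_1, …, z_m be elements of a commutative ring. Consider the polynomial P(t) := ∏_{k=0}^{m} (t² − z_k·t + 1) of degree 2m+2. Then P is monic and self-reciprocal: its coefficient of t^j equals its coefficient of t^{2m+2−j} for all 0 ≤ j ≤ 2m+2, the constant coefficient is 1, and writing a_j for the coefficient of t^{2m+2−j} (1 ≤ j ≤ m+1), one has for all admissible i: a_{2i−1} = −∑_{j=0}^{i−1} C(m−2j, i−j−1)·e_{2j+1}(z_0,…,z_m) and a_{2i} = ∑_{j=0}^{i} C(m−2j+1, i−j)·e_{2j}(z_0,…,z_m), where C(n,r) denotes the binomial coefficient and e_r denotes the r-th elementary symmetric polynomial in the m+1 variables z_0,…,z_m. -/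
open Polynomial Finset

noncomputable section

/-- The `r`-th elementary symmetric polynomial of `z 0, …, z m`. -/
def esym {R : Type*} [CommRing R] (m : ℕ) (z : Fin (m + 1) → R) (r : ℕ) : R :=
  ∑ s ∈ Finset.powersetCard r (Finset.univ : Finset (Fin (m + 1))), ∏ i ∈ s, z i

theorem aux_reflect {R : Type*} [CommRing R] {ι : Type*} (s : Finset ι) (z : ι → R) :
    (∏ k ∈ s, (X ^ 2 - C (z k) * X + 1 : R[X])).natDegree ≤ 2 * s.card ∧
    reflect (2 * s.card) (∏ k ∈ s, (X ^ 2 - C (z k) * X + 1 : R[X])) =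
      ∏ k ∈ s, (X ^ 2 - C (z k) * X + 1 : R[X]) := by
  classical
  induction s using Finset.induction_on with
  | empty => simp
  | insert a s ha ih =>
    have hd : (X ^ 2 - C (z a) * X + 1 : R[X]).natDegree ≤ 2 := by compute_degree
    have hr : reflect 2 (X ^ 2 - C (z a) * X + 1 : R[X]) = X ^ 2 - C (z a) * X + 1 := by
      have h1 : reflect 2 (X ^ 2 : R[X]) = 1 := by
        rw [reflect_monomial, revAt_le le_rfl]; simp
      have h2 : reflect 2 (C (z a) * X : R[X]) = C (z a) * X := by
        have := reflect_C_mul_X_pow (R := R) 2 1 (c := z a)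
        rw [revAt_le (by norm_num)] at this; simpa using this
      have h3 : reflect 2 (1 : R[X]) = X ^ 2 := by
        have := reflect_C (1 : R) 2
        simpa using this
      rw [reflect_add, reflect_sub, h1, h2, h3]; ring
    rw [Finset.prod_insert ha, Finset.card_insert_of_notMem ha,
      show 2 * (s.card + 1) = 2 + 2 * s.card by ring]
    refine ⟨natDegree_mul_le.trans (add_le_add hd ih.1), ?_⟩
    rw [reflect_mul _ _ hd ih.1, hr, ih.2]

theorem aux_coeff {R : Type*} [CommRing R] (N n r : ℕ) :
    ((X : R[X]) ^ r * (X ^ 2 + 1) ^ N).coeff n =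
      if r ≤ n ∧ 2 ∣ n - r then (N.choose ((n - r) / 2) : R) else 0 := by
  have : ((X : R[X]) ^ 2 + 1) ^ N = expand R 2 ((X + 1) ^ N) := by simp
  rw [coeff_X_pow_mul', this, coeff_expand (by norm_num), coeff_X_add_one_pow]
  split_ifs <;> simp_all

theorem aux_expand {R : Type*} [CommRing R] (m : ℕ) (z : Fin (m + 1) → R) :
    (∏ k : Fin (m + 1), (X ^ 2 - C (z k) * X + 1 : R[X])) =
      ∑ r ∈ Finset.range (m + 2), C ((-1) ^ r * esym m z r) *
        (X ^ r * (X ^ 2 + 1) ^ (m + 1 - r)) := by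
  have h : ∀ k, (X ^ 2 - C (z k) * X + 1 : R[X]) = (C (-1 * z k) * X) + (X ^ 2 + 1) := by
    intro k; simp; ring
  simp_rw [h]
  rw [Finset.prod_add, Finset.sum_powerset]
  simp only [Finset.card_univ, Fintype.card_fin]
  refine Finset.sum_congr rfl fun r _ => ?_
  rw [esym, Finset.mul_sum, map_sum, Finset.sum_mul]
  refine Finset.sum_congr rfl fun t ht => ?_
  rw [Finset.mem_powersetCard] at ht
  rw [Finset.prod_mul_distrib, Finset.prod_const, Finset.prod_const, ← map_prod,
    Finset.prod_mul_distrib, Finset.prod_const, Finset.card_sdiff_of_subset ht.1, ht.2]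
  simp [mul_assoc]

theorem aux_coeff_P {R : Type*} [CommRing R] (m : ℕ) (z : Fin (m + 1) → R) (n : ℕ) :
    (∏ k : Fin (m + 1), (X ^ 2 - C (z k) * X + 1 : R[X])).coeff n =
      ∑ r ∈ Finset.range (m + 2), ((-1) ^ r * esym m z r) *
        (if r ≤ n ∧ 2 ∣ n - r then ((m + 1 - r).choose ((n - r) / 2) : R) else 0) := by
  rw [aux_expand, finsetSum_coeff]
  simp_rw [coeff_C_mul, aux_coeff]

theorem self_reciprocal_coeffs {R : Type*} [CommRing R] (m : ℕ) (z : Fin (m + 1) → R)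
    (P : Polynomial R) (hP : P = ∏ k : Fin (m + 1), (X ^ 2 - C (z k) * X + 1)) :
    P.Monic ∧
    (∀ j ≤ 2 * m + 2, P.coeff j = P.coeff (2 * m + 2 - j)) ∧
    P.coeff 0 = 1 ∧
    (∀ i : ℕ, 1 ≤ i → 2 * i - 1 ≤ m + 1 →
      P.coeff (2 * m + 2 - (2 * i - 1)) =
        -∑ j ∈ Finset.range i, ((m - 2 * j).choose (i - j - 1) : R) * esym m z (2 * j + 1)) ∧
    (∀ i : ℕ, 1 ≤ i → 2 * i ≤ m + 1 →
      P.coeff (2 * m + 2 - 2 * i) =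
        ∑ j ∈ Finset.range (i + 1), ((m - 2 * j + 1).choose (i - j) : R) * esym m z (2 * j)) := by
  have hre := aux_reflect (Finset.univ : Finset (Fin (m + 1))) z
  rw [← hP] at hre
  simp only [Finset.card_univ, Fintype.card_fin] at hre
  obtain ⟨hdeg, hrefl⟩ := hre
  have hsym : ∀ j ≤ 2 * m + 2, P.coeff j = P.coeff (2 * m + 2 - j) := by
    intro j hj
    conv_lhs => rw [← hrefl]
    rw [coeff_reflect, revAt_le (by omega)]
    rfl
  have h0 : P.coeff 0 = 1 := by
    rw [hP, coeff_zero_prod]; simp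
  refine ⟨?_, hsym, h0, ?_, ?_⟩
  · apply monic_of_natDegree_le_of_coeff_eq_one _ hdeg
    rw [← h0, hsym 0 (by omega)]; rfl
  · intro i hi him
    rw [← hsym _ (by omega), hP, aux_coeff_P, ← Finset.sum_neg_distrib]
    symm
    refine Finset.sum_of_injOn (fun j => 2 * j + 1) (fun a _ b _ h => by simpa using h) ?_ ?_ ?_
    · intro j hj
      simp only [Finset.coe_range, Set.mem_Iio] at hj ⊢
      omega
    · intro r _ hr
      rw [if_neg, mul_zero]
      rintro ⟨h1, h2⟩
      apply hr
      exact ⟨r / 2, by simp only [Finset.coe_range, Set.mem_Iio]; omega, by dsimp only; omega⟩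
    · intro j hj
      rw [Finset.mem_range] at hj
      rw [if_pos (by omega), show m + 1 - (2 * j + 1) = m - 2 * j by omega,
        show (2 * i - 1 - (2 * j + 1)) / 2 = i - j - 1 by omega, pow_succ, pow_mul]
      simp [mul_comm]
  · intro i hi him
    rw [← hsym _ (by omega), hP, aux_coeff_P]
    symm
    refine Finset.sum_of_injOn (fun j => 2 * j) (fun a _ b _ h => by simpa using h) ?_ ?_ ?_
    · intro j hj
      simp only [Finset.coe_range, Set.mem_Iio] at hj ⊢
      omega
    · intro r _ hr
      rw [if_neg, mul_zero]
      rintro ⟨h1, h2⟩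
      apply hr
      exact ⟨r / 2, by simp only [Finset.coe_range, Set.mem_Iio]; omega, by dsimp only; omega⟩
    · intro j hj
      rw [Finset.mem_range] at hj
      have hc : (m - 2 * j + 1).choose (i - j) = (m + 1 - 2 * j).choose (i - j) := by
        rcases Nat.lt_or_ge m (2 * j) with h | h
        · rw [show i - j = 0 by omega]; simp
        · rw [show m - 2 * j + 1 = m + 1 - 2 * j by omega]
      rw [if_pos (by omega), hc,
        show (2 * i - 2 * j) / 2 = i - j by omega, pow_mul]
      simp [mul_comm]

end
end

section
/- Let m ≥ 0 and let z_0, z_1, …, z_m be elements of a commutative ring. Let M be the (m+1)×(m+1) matrix whose (i,j) entry (with 0 ≤ i, j ≤ m) is e_i(z_0, …, z_{j−1}, z_{j+1}, …, z_m), the i-th elementary symmetric polynomial of the m variables obtained from z_0, …, z_m by omitting z_j. Then det M = ∏_{0≤i<j≤m} (z_i − z_j). -/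
theorem esymm_insert_succ_aux {R ι : Type*} [CommRing R] [DecidableEq ι] (z : ι → R)
    (s : Finset ι) (j : ι) (hj : j ∉ s) (i : ℕ) :
    ∑ t ∈ Finset.powersetCard (i + 1) (insert j s), ∏ k ∈ t, z k
      = ∑ t ∈ Finset.powersetCard (i + 1) s, ∏ k ∈ t, z k
        + z j * ∑ t ∈ Finset.powersetCard i s, ∏ k ∈ t, z k := by
  have hn : ∀ n, ∀ t ∈ Finset.powersetCard n s, j ∉ t := fun n t ht h =>
    hj ((Finset.mem_powersetCard.1 ht).1 h)
  rw [Finset.powersetCard_succ_insert hj, Finset.sum_union, Finset.sum_image, Finset.mul_sum]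
  · congr 1
    refine Finset.sum_congr rfl fun t ht => ?_
    rw [Finset.prod_insert (hn _ t ht)]
  · intro a ha b hb hab
    have h1 := hn _ a ha
    have h2 := hn _ b hb
    rw [← Finset.erase_insert h1, ← Finset.erase_insert h2]
    exact congrArg (fun x => Finset.erase x j) hab
  · rw [Finset.disjoint_left]
    intro a ha hb
    obtain ⟨b, -, rfl⟩ := Finset.mem_image.1 hb
    exact hn _ _ ha (Finset.mem_insert_self _ _)

theorem esymm_erase_aux {R ι : Type*} [CommRing R] [DecidableEq ι] (z : ι → R)
    (s : Finset ι) (j : ι) (hj : j ∉ s) (i : ℕ) :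
    ∑ t ∈ Finset.powersetCard i s, ∏ k ∈ t, z k
      = ∑ l ∈ Finset.range (i + 1),
        (∑ t ∈ Finset.powersetCard (i - l) (insert j s), ∏ k ∈ t, z k) * (- z j) ^ l := by
  induction i with
  | zero => simp
  | succ i ih =>
    rw [Finset.sum_range_succ']
    simp only [Nat.add_sub_add_right, pow_succ, ← mul_assoc, ← Finset.sum_mul]
    rw [← ih, Nat.sub_zero, esymm_insert_succ_aux z s j hj]
    ring

theorem det_esymm_omit_eq_vandermonde {R : Type*} [CommRing R] (m : ℕ)
    (z : Fin (m + 1) → R) :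
    (Matrix.of fun i j : Fin (m + 1) =>
        ∑ s ∈ Finset.powersetCard (i : ℕ) ((Finset.univ : Finset (Fin (m + 1))).erase j),
          ∏ k ∈ s, z k).det
      = ∏ i, ∏ j ∈ Finset.Ioi i, (z i - z j) := by
  let L : Matrix (Fin (m + 1)) (Fin (m + 1)) R := Matrix.of fun i l =>
    if (l : ℕ) < i + 1 then ∑ t ∈ Finset.powersetCard ((i : ℕ) - l)
      (Finset.univ : Finset (Fin (m + 1))), ∏ k ∈ t, z k else 0
  have hM : (Matrix.of fun i j : Fin (m + 1) =>
        ∑ s ∈ Finset.powersetCard (i : ℕ) ((Finset.univ : Finset (Fin (m + 1))).erase j),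
          ∏ k ∈ s, z k) = L * (Matrix.vandermonde (fun i => - z i)).transpose := by
    ext i j
    rw [Matrix.mul_apply]
    simp only [L, Matrix.of_apply, Matrix.transpose_apply, Matrix.vandermonde_apply]
    rw [esymm_erase_aux z _ j (Finset.notMem_erase j _),
      Finset.insert_erase (Finset.mem_univ j),
      Fin.sum_univ_eq_sum_range (fun l => (if l < (i : ℕ) + 1 then
        ∑ t ∈ Finset.powersetCard ((i : ℕ) - l)
          (Finset.univ : Finset (Fin (m + 1))), ∏ k ∈ t, z k else 0) * (- z j) ^ l) (m + 1)]
    have hsub : Finset.range ((i : ℕ) + 1) ⊆ Finset.range (m + 1) :=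
      Finset.range_subset_range.2 i.2
    rw [← Finset.sum_subset hsub]
    · refine Finset.sum_congr rfl fun l hl => ?_
      rw [if_pos (Finset.mem_range.1 hl)]
    · intro l _ hl
      rw [if_neg (fun h => hl (Finset.mem_range.2 h)), zero_mul]
  have hL : L.det = 1 := by
    rw [Matrix.det_of_lowerTriangular]
    · simp [L]
    · intro i j hij
      have h : i < j := hij
      have h' : ¬ ((j : ℕ) < i + 1) := by
        have := Fin.lt_def.1 h
        omega
      simp only [L, Matrix.of_apply, if_neg h']
  rw [hM, Matrix.det_mul, hL, one_mul, Matrix.det_transpose, Matrix.det_vandermonde]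
  refine Finset.prod_congr rfl fun i _ => Finset.prod_congr rfl fun j _ => ?_
  ring
end

section
/- For every integer m ≥ 1, ∫_{[0,1]^m} ∏_{1≤i<j≤m} |y_i − y_j| dy_1⋯dy_m = m! · ∏_{k=0}^{m−1} (k!)²/(2k+1)!. -/
open MeasureTheory

namespace SelbergAux

/-- The absolute Vandermonde product. -/
noncomputable def V {n : ℕ} (y : Fin n → ℝ) : ℝ := ∏ i, ∏ j ∈ Finset.Ioi i, |y i - y j|

/-- Lebesgue measure on the unit cube. -/
noncomputable def mu (n : ℕ) : Measure (Fin n → ℝ) :=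
  Measure.pi (fun _ => (volume : Measure ℝ).restrict (Set.Icc 0 1))

lemma mu_eq (n : ℕ) : (volume : Measure (Fin n → ℝ)).restrict
    (Set.univ.pi (fun _ : Fin n => Set.Icc (0 : ℝ) 1)) = mu n := by
  rw [mu, ← Measure.restrict_pi_pi]; rfl

instance (n : ℕ) : IsProbabilityMeasure (mu n) := by
  have : IsProbabilityMeasure ((volume : Measure ℝ).restrict (Set.Icc 0 1)) := ⟨by simp⟩
  unfold mu; infer_instance

lemma V_eq {n : ℕ} (y : Fin n → ℝ) : V y = |(Matrix.vandermonde y).det| := by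
  rw [Matrix.det_vandermonde, Finset.abs_prod, V]
  refine Finset.prod_congr rfl fun i _ => ?_
  rw [Finset.abs_prod]
  exact Finset.prod_congr rfl fun j _ => abs_sub_comm _ _

lemma V_perm {n : ℕ} (y : Fin n → ℝ) (σ : Equiv.Perm (Fin n)) :
    V (fun i => y (σ i)) = V y := by
  rw [V_eq, V_eq]
  have : Matrix.vandermonde (fun i => y (σ i)) = (Matrix.vandermonde y).submatrix σ id := by
    ext i j; simp [Matrix.vandermonde]
  rw [this, Matrix.det_permute, abs_mul]
  rcases Int.units_eq_one_or (Equiv.Perm.sign σ) with h | h <;> simp [h]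

lemma V_zero {n : ℕ} (y : Fin n → ℝ) {i j : Fin n} (hij : i ≠ j) (h : y i = y j) : V y = 0 := by
  rw [V_eq, abs_eq_zero]
  by_contra hne
  exact hij (Matrix.det_vandermonde_ne_zero_iff.1 hne h)

lemma V_succ {n : ℕ} (y : Fin (n + 1) → ℝ) :
    V y = (∏ j : Fin n, |y 0 - y j.succ|) * V (fun i : Fin n => y i.succ) := by
  rw [V, Fin.prod_univ_succ, Fin.prod_Ioi_zero, V]
  congr 1
  exact Finset.prod_congr rfl fun i _ => Fin.prod_Ioi_succ _ _

lemma V_cont {n : ℕ} : Continuous (V : (Fin n → ℝ) → ℝ) := by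
  unfold V; fun_prop

lemma int_cont {n : ℕ} {f : (Fin n → ℝ) → ℝ} (hf : Continuous f) : Integrable f (mu n) := by
  rw [← mu_eq]
  exact hf.continuousOn.integrableOn_compact (isCompact_univ_pi fun _ => isCompact_Icc)

lemma prod_div_bound {n : ℕ} (x : Fin n → ℝ) (t : ℝ) (j : Fin n) :
    |(∏ l, |t - x l|) / (t - x j)| ≤ ∏ l ∈ Finset.univ.erase j, |t - x l| := by
  rw [← Finset.mul_prod_erase Finset.univ _ (Finset.mem_univ j)]
  have h0 : 0 ≤ ∏ l ∈ Finset.univ.erase j, |t - x l| :=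
    Finset.prod_nonneg fun _ _ => abs_nonneg _
  rw [abs_div, abs_mul, abs_abs, abs_of_nonneg h0]
  by_cases h : |t - x j| = 0
  · rw [h]; simpa using h0
  · rw [mul_div_assoc, mul_div_cancel₀]
    exact h

lemma int_div {n : ℕ} {f : (Fin (n + 1) → ℝ) → ℝ} (hf : Continuous f) (j : Fin n) :
    Integrable (fun y => f y * (V y / (y 0 - y j.succ))) (mu (n + 1)) := by
  have hg : Continuous fun y : Fin (n + 1) → ℝ => f y *
      ((∏ l ∈ Finset.univ.erase j, |y 0 - y l.succ|) * V (fun i : Fin n => y i.succ)) := by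
    unfold V; fun_prop
  refine (int_cont hg).mono ?_ ?_
  · have := V_cont (n := n + 1)
    have h1 : Measurable fun y : Fin (n + 1) → ℝ => f y * (V y / (y 0 - y j.succ)) := by
      have := this.measurable
      have := hf.measurable
      fun_prop
    exact h1.aestronglyMeasurable
  · refine Filter.Eventually.of_forall fun y => ?_
    rw [norm_mul, norm_mul]
    refine mul_le_mul_of_nonneg_left ?_ (norm_nonneg _)
    rw [V_succ, mul_div_right_comm, norm_mul, norm_mul]
    refine mul_le_mul_of_nonneg_right ?_ (norm_nonneg _)
    exact (prod_div_bound (fun l => y l.succ) (y 0) j).trans (le_abs_self _)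

lemma ftc {n : ℕ} (x : Fin n → ℝ) (g g' : ℝ → ℝ) (hg : ∀ t, HasDerivAt g (g' t) t)
    (hg' : Continuous g') :
    ∫ t in Set.Icc (0 : ℝ) 1, (g' t * (∏ l, |t - x l|) +
      ∑ j, g t * ((∏ l, |t - x l|) / (t - x j)))
    = g 1 * (∏ l, |1 - x l|) - g 0 * (∏ l, |0 - x l|) := by
  have hgc : Continuous g := continuous_iff_continuousAt.2 fun t => (hg t).continuousAt
  rw [integral_Icc_eq_integral_Ioc, ← intervalIntegral.integral_of_le zero_le_one]
  refine integral_eq_of_hasDerivAt_off_countable_of_le (fun t => g t * ∏ l, |t - x l|) _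
    zero_le_one (s := Set.range x) (Set.countable_range x) ?_ ?_ ?_
  · fun_prop
  · rintro t ⟨-, ht⟩
    have hne : ∀ j, t - x j ≠ 0 := fun j h => ht ⟨j, (sub_eq_zero.1 h).symm⟩
    have h1 : ∀ j ∈ (Finset.univ : Finset (Fin n)),
        HasDerivAt (fun t => |t - x j|) (|t - x j| / (t - x j)) t := by
      intro j _
      have := (hasDerivAt_abs (hne j)).comp t ((hasDerivAt_id t).sub_const (x j))
      convert! this using 1
      rcases lt_or_gt_of_ne (hne j) with h | h
      · rw [abs_of_neg h, sign_neg h, neg_div, div_self (hne j)]; simp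
      · rw [abs_of_pos h, sign_pos h, div_self (hne j)]; simp
    have h2 := (hg t).mul (HasDerivAt.fun_finsetProd h1)
    convert! h2 using 1
    rw [Finset.mul_sum]
    congr 1
    refine Finset.sum_congr rfl fun j _ => ?_
    rw [← Finset.mul_prod_erase Finset.univ _ (Finset.mem_univ j), smul_eq_mul]
    ring
  · have hI : ∀ {f : ℝ → ℝ}, Continuous f → IntervalIntegrable f volume 0 1 :=
      fun hf => hf.intervalIntegrable _ _
    refine (hI (by fun_prop)).add ?_
    have : (fun t => ∑ j, g t * ((∏ l, |t - x l|) / (t - x j))) =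
      ∑ j, fun t => g t * ((∏ l, |t - x l|) / (t - x j)) := by ext t; simp
    rw [this]
    refine IntervalIntegrable.sum _ fun j _ => ?_
    refine (hI (f := fun t => g t * ∏ l ∈ Finset.univ.erase j, |t - x l|)
      (by fun_prop)).mono_fun ?_ ?_
    · have := hgc.measurable
      exact (by fun_prop : Measurable _).aestronglyMeasurable
    · refine Filter.Eventually.of_forall fun t => ?_
      dsimp only
      rw [norm_mul, norm_mul]
      refine mul_le_mul_of_nonneg_left ?_ (norm_nonneg _)
      exact (prod_div_bound x t j).trans (le_abs_self _)

lemma ibp {n : ℕ} (g g' : ℝ → ℝ) (hg : ∀ t, HasDerivAt g (g' t) t) (hg' : Continuous g')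
    (G : (Fin n → ℝ) → ℝ) (hG : Continuous G) :
    (∫ y, g' (y 0) * G (fun i => y i.succ) * V y ∂mu (n + 1)) +
      ∑ j : Fin n, ∫ y, (g (y 0) * G (fun i => y i.succ)) * (V y / (y 0 - y j.succ)) ∂mu (n + 1)
    = ∫ x, (g 1 * (∏ l, |1 - x l|) - g 0 * (∏ l, |0 - x l|)) * (G x * V x) ∂mu n := by
  have hgc : Continuous g := continuous_iff_continuousAt.2 fun t => (hg t).continuousAt
  have hVc := V_cont (n := n + 1)
  have i1 : Integrable (fun y => g' (y 0) * G (fun i => y i.succ) * V y) (mu (n + 1)) :=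
    int_cont (by fun_prop)
  have i2 : ∀ j ∈ (Finset.univ : Finset (Fin n)), Integrable (fun y => (g (y 0) *
      G (fun i => y i.succ)) * (V y / (y 0 - y j.succ))) (mu (n + 1)) := by
    intro j _
    exact int_div (f := fun y => g (y 0) * G (fun i => y i.succ)) (by fun_prop) j
  rw [← integral_finsetSum _ i2, ← integral_add i1 (integrable_finsetSum _ i2)]
  have i3 := i1.add (integrable_finsetSum _ i2)
  have mp := (measurePreserving_piFinSuccAbove
    (fun _ : Fin (n + 1) => (volume : Measure ℝ).restrict (Set.Icc 0 1)) 0).symm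
  change MeasurePreserving _ (((volume : Measure ℝ).restrict (Set.Icc 0 1)).prod (mu n))
    (mu (n + 1)) at mp
  rw [← mp.integral_comp', integral_prod_symm]
  · refine integral_congr_ae (Filter.Eventually.of_forall fun x => ?_)
    dsimp only
    rw [← ftc x g g' hg hg', ← integral_mul_const]
    refine integral_congr_ae (Filter.Eventually.of_forall fun t => ?_)
    have e0 : ((MeasurableEquiv.piFinSuccAbove (fun _ : Fin (n + 1) => ℝ) 0).symm (t, x))
        = (Fin.cons t x : Fin (n + 1) → ℝ) := by
      simp only [MeasurableEquiv.piFinSuccAbove_symm_apply, Fin.insertNthEquiv_apply]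
      exact Fin.insertNth_zero' t x
    simp only [e0, V_succ, Fin.cons_zero, Fin.cons_succ]
    rw [add_mul, Finset.sum_mul]
    congr 1
    · ring
    · refine Finset.sum_congr rfl fun j _ => ?_
      ring
  · exact (mp.integrable_comp_emb (MeasurableEquiv.measurableEmbedding _)).2 i3

lemma perm_int {n : ℕ} (σ : Equiv.Perm (Fin n)) (f : (Fin n → ℝ) → ℝ) :
    ∫ y, f (fun i => y (σ i)) ∂mu n = ∫ y, f y ∂mu n := by
  have mp := measurePreserving_piCongrLeft
    (fun _ : Fin n => (volume : Measure ℝ).restrict (Set.Icc 0 1)) σ.symm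
  change MeasurePreserving _ (mu n) (mu n) at mp
  rw [← mp.integral_comp' f]
  refine integral_congr_ae (Filter.Eventually.of_forall fun y => ?_)
  dsimp only
  congr 1
  ext i
  have := MeasurableEquiv.piCongrLeft_apply_apply (β := fun _ : Fin n => ℝ) σ.symm y (σ i)
  simpa using this.symm

lemma swap_int {n : ℕ} (F h : (Fin (n + 1) → ℝ) → ℝ) (hF : Continuous F) (j : Fin n)
    (H : ∀ y, F y - F (fun i => y (Equiv.swap 0 j.succ i)) = (y 0 - y j.succ) * h y) :
    ∫ y, F y * (V y / (y 0 - y j.succ)) ∂mu (n + 1) = (∫ y, h y * V y ∂mu (n + 1)) / 2 := by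
  have h1 := perm_int (Equiv.swap 0 j.succ) (fun y => F y * (V y / (y 0 - y j.succ)))
  have i1 := int_div hF j
  have i2 : Integrable (fun y => F (fun i => y (Equiv.swap 0 j.succ i)) *
    (V y / (y 0 - y j.succ))) (mu (n + 1)) := int_div (f := fun y =>
      F (fun i => y (Equiv.swap 0 j.succ i))) (by fun_prop) j
  have h2 : ∫ y, F (fun i => y (Equiv.swap 0 j.succ i)) * (V y / (y 0 - y j.succ)) ∂mu (n + 1)
      = - ∫ y, F y * (V y / (y 0 - y j.succ)) ∂mu (n + 1) := by
    rw [← h1, ← integral_neg]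
    refine integral_congr_ae (Filter.Eventually.of_forall fun y => ?_)
    dsimp only
    rw [V_perm, Equiv.swap_apply_left, Equiv.swap_apply_right, ← neg_sub (y 0), div_neg]
    ring
  have h3 : ∫ y, h y * V y ∂mu (n + 1) = ∫ y, (F y * (V y / (y 0 - y j.succ)) -
      F (fun i => y (Equiv.swap 0 j.succ i)) * (V y / (y 0 - y j.succ))) ∂mu (n + 1) := by
    refine integral_congr_ae (Filter.Eventually.of_forall fun y => ?_)
    dsimp only
    rw [← sub_mul, H]
    by_cases hy : y 0 = y j.succ
    · rw [V_zero y (Fin.succ_ne_zero j).symm hy]; simp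
    · have := sub_ne_zero.2 hy
      field_simp
  rw [h3, integral_sub i1 i2, h2]
  ring

/-- Aomoto's integrals. -/
noncomputable def A (n : ℕ) (S : Finset (Fin n)) : ℝ := ∫ y, (∏ i ∈ S, y i) * V y ∂mu n

lemma A_card {n : ℕ} (S T : Finset (Fin n)) (h : S.card = T.card) : A n S = A n T := by
  obtain ⟨σ, hσ⟩ : ∃ σ : Equiv.Perm (Fin n), S.map σ.toEmbedding = T := by
    obtain ⟨e⟩ : Nonempty ({x // x ∈ S} ≃ {x // x ∈ T}) := by
      rw [← Fintype.card_eq]; simpa using h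
    refine ⟨e.extendSubtype, ?_⟩
    refine Finset.eq_of_subset_of_card_le ?_ (by simp [h])
    intro y hy
    obtain ⟨x, hx, rfl⟩ := Finset.mem_map.1 hy
    exact e.extendSubtype_mem x hx
  rw [A, A, ← perm_int σ (fun y => (∏ i ∈ S, y i) * V y), ← hσ]
  refine integral_congr_ae (Filter.Eventually.of_forall fun y => ?_)
  dsimp only
  rw [V_perm, Finset.prod_map]
  rfl

lemma A_map {n : ℕ} (T : Finset (Fin n)) :
    A (n + 1) (T.map (Fin.succEmb n)) = ∫ y, (∏ i ∈ T, y i.succ) * V y ∂mu (n + 1) := by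
  simp [A, Finset.prod_map]

lemma A_insert {n : ℕ} (T : Finset (Fin n)) :
    A (n + 1) (insert 0 (T.map (Fin.succEmb n)))
      = ∫ y, (y 0 * ∏ i ∈ T, y i.succ) * V y ∂mu (n + 1) := by
  have : (0 : Fin (n + 1)) ∉ T.map (Fin.succEmb n) := by simp [Fin.succ_ne_zero]
  simp [A, Finset.prod_map, Finset.prod_insert this]

lemma swap_succ_ne {n : ℕ} {i j : Fin n} (h : i ≠ j) :
    Equiv.swap 0 j.succ i.succ = i.succ :=
  Equiv.swap_apply_of_ne_of_ne (Fin.succ_ne_zero i) (fun h' => h (Fin.succ_injective _ h'))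

lemma aomoto {n : ℕ} (T : Finset (Fin n)) :
    A (n + 1) (insert 0 (T.map (Fin.succEmb n))) * (2 * n + 4 - T.card)
      = A (n + 1) (T.map (Fin.succEmb n)) * (n + 2 - T.card) := by
  have hVc := V_cont (n := n + 1)
  set a := A (n + 1) (T.map (Fin.succEmb n)) with ha
  set b := A (n + 1) (insert 0 (T.map (Fin.succEmb n))) with hb
  have key := ibp (n := n) (fun t => t - t ^ 2) (fun t => 1 - 2 * t)
    (fun t => by simpa using (hasDerivAt_id' t).fun_sub (hasDerivAt_pow 2 t)) (by fun_prop)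
    (fun x => ∏ i ∈ T, x i) (by fun_prop)
  simp only [one_pow, sub_self, zero_mul, ne_eq, OfNat.ofNat_ne_zero, not_false_eq_true, zero_pow,
    integral_zero] at key
  have h1 : ∫ y, (1 - 2 * y 0) * (∏ i ∈ T, y i.succ) * V y ∂mu (n + 1) = a - 2 * b := by
    rw [ha, hb, A_map, A_insert, ← integral_const_mul, ← integral_sub]
    · congr 1; ext y; ring
    · exact int_cont (by fun_prop)
    · exact int_cont (by fun_prop)
  have h2 : ∀ j : Fin n, ∫ y, ((y 0 - y 0 ^ 2) * ∏ i ∈ T, y i.succ) *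
      (V y / (y 0 - y j.succ)) ∂mu (n + 1) = if j ∈ T then -b / 2 else a / 2 - b := by
    intro j
    split_ifs with hj
    · rw [swap_int (fun y => (y 0 - y 0 ^ 2) * ∏ i ∈ T, y i.succ)
        (fun y => - (y 0 * ∏ i ∈ T, y i.succ)) (by fun_prop) j, hb, A_insert]
      · simp [integral_neg]
      · intro y
        have e : ∏ i ∈ T.erase j, y (Equiv.swap 0 j.succ i.succ) = ∏ i ∈ T.erase j, y i.succ :=
          Finset.prod_congr rfl fun i hi => by rw [swap_succ_ne (Finset.ne_of_mem_erase hi)]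
        rw [← Finset.mul_prod_erase T _ hj, ← Finset.mul_prod_erase T _ hj, e]
        dsimp only
        rw [
          Equiv.swap_apply_left, Equiv.swap_apply_right]
        ring
    · rw [swap_int (fun y => (y 0 - y 0 ^ 2) * ∏ i ∈ T, y i.succ)
        (fun y => (1 - y 0 - y j.succ) * ∏ i ∈ T, y i.succ) (by fun_prop) j]
      · have hb' : b = ∫ y, (y j.succ * ∏ i ∈ T, y i.succ) * V y ∂mu (n + 1) := by
          rw [hb, A_card _ ((insert j T).map (Fin.succEmb n)), A_map]
          · simp_rw [Finset.prod_insert hj]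
          · rw [Finset.card_insert_of_notMem (by simp [Fin.succ_ne_zero]), Finset.card_map,
              Finset.card_map, Finset.card_insert_of_notMem hj]
        have : ∫ y, ((1 - y 0 - y j.succ) * ∏ i ∈ T, y i.succ) * V y ∂mu (n + 1)
            = a - b - b := by
          nth_rewrite 2 [hb']
          rw [ha, hb, A_map, A_insert, ← integral_sub, ← integral_sub]
          · congr 1; ext y; ring
          all_goals exact int_cont (by fun_prop)
        rw [this]; ring
      · intro y
        have e : ∏ i ∈ T, y (Equiv.swap 0 j.succ i.succ) = ∏ i ∈ T, y i.succ :=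
          Finset.prod_congr rfl fun i hi => by
            rw [swap_succ_ne (ne_of_mem_of_not_mem hi hj)]
        rw [e]
        dsimp only
        rw [Equiv.swap_apply_left]
        ring
  rw [h1, Finset.sum_congr rfl fun j _ => h2 j, Finset.sum_ite, Finset.sum_const,
    Finset.sum_const, Finset.filter_mem_eq_inter, Finset.univ_inter, Finset.filter_notMem_eq_sdiff,
    Finset.card_sdiff_of_subset (Finset.subset_univ T), Finset.card_univ, Fintype.card_fin,
    nsmul_eq_mul, nsmul_eq_mul, Nat.cast_sub (by simpa using T.card_le_univ)] at key
  linarith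

lemma euler (n : ℕ) : (1 + (n : ℝ) / 2) * A (n + 1) ∅ = A n Finset.univ := by
  have key := ibp (n := n) (fun t => t - 1) (fun t => 1)
    (fun t => by simpa using (hasDerivAt_id t).sub_const 1) (by fun_prop)
    (fun x => 1) (by fun_prop)
  have h2 : ∀ j : Fin n, ∫ y, ((y 0 - 1) * 1) *
      (V y / (y 0 - y j.succ)) ∂mu (n + 1) = A (n + 1) ∅ / 2 := by
    intro j
    rw [swap_int (fun y => (y 0 - 1) * 1) (fun y => 1) (by fun_prop) j]
    · simp [A]
    · intro y; simp
  rw [Finset.sum_congr rfl fun j _ => h2 j, Finset.sum_const, Finset.card_univ,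
    Fintype.card_fin, nsmul_eq_mul] at key
  have h3 : ∫ y, (1 : ℝ) * 1 * V y ∂mu (n + 1) = A (n + 1) ∅ := by simp [A]
  rw [h3] at key
  have h4 : ∀ᵐ x ∂mu n, ∀ i, 0 ≤ x i := by
    rw [← mu_eq]
    filter_upwards [ae_restrict_mem (MeasurableSet.univ_pi fun _ => measurableSet_Icc)] with x hx i
    exact (hx i (Set.mem_univ i)).1
  have h5 : A n Finset.univ = ∫ x, ((1 - 1) * (∏ l, |1 - x l|) - (0 - 1) * (∏ l, |0 - x l|)) *
      (1 * V x) ∂mu n := by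
    refine integral_congr_ae ?_
    filter_upwards [h4] with x hx
    have : ∏ l, |0 - x l| = ∏ l, x l :=
      Finset.prod_congr rfl fun l _ => by rw [zero_sub, abs_neg, abs_of_nonneg (hx l)]
    rw [this]; ring
  rw [h5, ← key]; ring

lemma aomoto_iter (n k d : ℕ) (h : n + 1 = k + d) (S : Finset (Fin (n + 1))) (hS : S.card = k) :
    A (n + 1) S * ((d + 1).factorial * (2 * n + 4).factorial)
      = A (n + 1) ∅ * ((n + 2).factorial * (n + 3 + d).factorial) := by
  induction k generalizing d S with
  | zero =>
    have : S = ∅ := Finset.card_eq_zero.1 hS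
    subst this
    have : d = n + 1 := by omega
    subst this
    rw [show n + 3 + (n + 1) = 2 * n + 4 by ring]
  | succ k ih =>
    obtain ⟨T, -, hT⟩ := Finset.exists_subset_card_eq (s := (Finset.univ : Finset (Fin n)))
      (n := k) (by simp; omega)
    have h1 := ih (d + 1) (by omega) (T.map (Fin.succEmb n)) (by simpa using hT)
    have h2 := aomoto T
    have h3 : A (n + 1) S = A (n + 1) (insert 0 (T.map (Fin.succEmb n))) := by
      apply A_card
      rw [Finset.card_insert_of_notMem (by simp [Fin.succ_ne_zero]), Finset.card_map, hT, hS]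
    rw [← h3, hT] at h2
    have hn : (n : ℝ) = k + d := by
      have : n = k + d := by omega
      rw [this]; push_cast; ring
    rw [show (2 * n + 4 - k : ℝ) = (n : ℝ) + 4 + d by rw [hn]; ring,
      show (n + 2 - k : ℝ) = d + 2 by rw [hn]; ring] at h2
    rw [show n + 3 + (d + 1) = (n + 3 + d) + 1 by ring, Nat.factorial_succ (n + 3 + d),
      Nat.factorial_succ (d + 1)] at h1
    push_cast at h1
    have hp : ((n : ℝ) + 4 + d) ≠ 0 := by positivity
    apply mul_left_cancel₀ hp
    linear_combination h1 + ((d + 1).factorial * (2 * n + 4).factorial : ℝ) * h2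

lemma A_univ (n : ℕ) : A n Finset.univ * (2 * n + 2).factorial
    = A n ∅ * ((n + 1).factorial * (n + 2).factorial) := by
  cases n with
  | zero => simp [Finset.univ_eq_empty]
  | succ n =>
    have := aomoto_iter n (n + 1) 0 rfl Finset.univ (by simp)
    simpa [show 2 * (n + 1) + 2 = 2 * n + 4 by ring] using this

lemma A_formula (m : ℕ) : A m ∅ = (m.factorial : ℝ) *
    ∏ k ∈ Finset.range m, ((k.factorial : ℝ)) ^ 2 / ((2 * k + 1).factorial : ℝ) := by
  induction m with
  | zero => simp [A, V]
  | succ n ih =>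
    have h1 := euler n
    have h2 := A_univ n
    rw [← h1, ih, Nat.factorial_succ (2 * n + 1), Nat.factorial_succ (n + 1),
      Nat.factorial_succ n] at h2
    rw [Finset.prod_range_succ, Nat.factorial_succ n]
    push_cast at h2 ⊢
    set Q := ∏ k ∈ Finset.range n, ((k.factorial : ℝ)) ^ 2 / ((2 * k + 1).factorial : ℝ)
    have hf : ((2 * n + 1).factorial : ℝ) ≠ 0 := by positivity
    have hp : ((n : ℝ) + 2) * (n + 1) ≠ 0 := by positivity
    field_simp
    apply mul_left_cancel₀ hp
    linear_combination h2

end SelbergAux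

theorem selberg_unit_cube (m : ℕ) (hm : 1 ≤ m) :
    (∫ y in Set.univ.pi (fun _ : Fin m => Set.Icc (0 : ℝ) 1),
        ∏ i, ∏ j ∈ Finset.Ioi i, |y i - y j|)
      = (m.factorial : ℝ) *
          ∏ k ∈ Finset.range m, ((k.factorial : ℝ)) ^ 2 / ((2 * k + 1).factorial : ℝ) := by
  rw [← SelbergAux.A_formula, SelbergAux.mu_eq]
  simp [SelbergAux.A, SelbergAux.V]
end

section
/- For every integer m ≥ 1, ∫_{[−1,1]^m} ∏_{1≤i<j≤m} |x_i − x_j| dx_1⋯dx_m = 2^{m(m+1)/2} · m! · ∏_{k=0}^{m−1} (k!)²/(2k+1)!. -/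
open MeasureTheory

noncomputable def sg (a : ℝ) : ℝ := ((SignType.sign a : SignType) : ℝ)

lemma sg_mul (a b : ℝ) : sg (a * b) = sg a * sg b := by simp [sg, sign_mul]
lemma sg_pos {a : ℝ} (h : 0 < a) : sg a = 1 := by simp [sg, sign_pos h]
lemma sg_neg {a : ℝ} (h : a < 0) : sg a = -1 := by simp [sg, sign_neg h]
lemma sg_neg' (a : ℝ) : sg (-a) = - sg a := by simp [sg, Left.sign_neg]
lemma sg_swap (a b : ℝ) : sg (a - b) = - sg (b - a) := by rw [← sg_neg', neg_sub]
lemma sg_mul_self_abs (a : ℝ) : a * sg a = |a| := by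
  rcases lt_trichotomy a 0 with h | h | h
  · rw [sg_neg h, abs_of_neg h]; ring
  · simp [h]
  · rw [sg_pos h, abs_of_pos h]; ring
lemma sg_sq {a : ℝ} (h : a ≠ 0) : sg a * sg a = 1 := by
  rcases lt_or_gt_of_ne h with h | h
  · rw [sg_neg h]; ring
  · rw [sg_pos h]; ring
lemma abs_sg_le (a : ℝ) : |sg a| ≤ 1 := by
  rcases lt_trichotomy a 0 with h | h | h
  · simp [sg_neg h]
  · simp [h, sg]
  · simp [sg_pos h]
lemma sg_prod {ι : Type*} (s : Finset ι) (f : ι → ℝ) : sg (∏ i ∈ s, f i) = ∏ i ∈ s, sg (f i) := by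
  classical
  induction s using Finset.induction_on with
  | empty => simp [sg]
  | insert a s ha ih => rw [Finset.prod_insert ha, Finset.prod_insert ha, sg_mul, ih]
lemma measurable_sg : Measurable sg := by
  have : sg = fun a : ℝ => if a < 0 then (-1 : ℝ) else if 0 < a then 1 else 0 := by
    funext a
    split_ifs with h h'
    · exact sg_neg h
    · exact sg_pos h'
    · have : a = 0 := le_antisymm (not_lt.1 h') (not_lt.1 h)
      simp [this, sg]
  rw [this]
  exact Measurable.ite measurableSet_Iio measurable_const
    (Measurable.ite measurableSet_Ioi measurable_const measurable_const)

noncomputable def SS {n : ℕ} (x : Fin n → ℝ) : ℝ := ∏ i, ∏ j ∈ Finset.Ioi i, sg (x j - x i)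

lemma SS_eq {n : ℕ} (x : Fin n → ℝ) : SS x = sg (Matrix.vandermonde x).det := by
  rw [Matrix.det_vandermonde, sg_prod]
  simp only [sg_prod, SS]

lemma SS_perm {n : ℕ} (x : Fin n → ℝ) (σ : Equiv.Perm (Fin n)) :
    SS (fun i => x (σ i)) = ((Equiv.Perm.sign σ : ℤ) : ℝ) * SS x := by
  rw [SS_eq, SS_eq]
  have : Matrix.vandermonde (fun i => x (σ i)) = (Matrix.vandermonde x).submatrix σ id := by
    ext i j; simp [Matrix.vandermonde]
  rw [this, Matrix.det_permute, sg_mul]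
  congr 1
  rcases Int.units_eq_one_or (Equiv.Perm.sign σ) with h | h
  · simp [h, sg]
  · simp [h, sg]

lemma SS_cons {n : ℕ} (x : Fin (n+1) → ℝ) :
    SS x = (∏ l : Fin n, sg (x l.succ - x 0)) * SS (fun l : Fin n => x l.succ) := by
  unfold SS
  rw [Fin.prod_univ_succ, Fin.prod_Ioi_zero]
  congr 1
  apply Finset.prod_congr rfl
  intro i _
  rw [Fin.prod_Ioi_succ]

lemma SS_above {n : ℕ} (x : Fin (n+1) → ℝ) (i : Fin (n+1)) :
    SS x = (-1) ^ (i : ℕ) * (∏ l : Fin n, sg (x (i.succAbove l) - x i)) *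
      SS (fun l => x (i.succAbove l)) := by
  have h := SS_perm x i.cycleRange.symm
  rw [SS_cons] at h
  simp only [Fin.cycleRange_symm_zero, Fin.cycleRange_symm_succ, Equiv.Perm.sign_symm,
    Fin.sign_cycleRange] at h
  rw [mul_assoc, h]
  push_cast
  rw [← mul_assoc, ← mul_pow]
  simp

lemma SS_above' {n : ℕ} (x : Fin (n+1) → ℝ) (hx : Function.Injective x) (i : Fin (n+1)) :
    SS x * ∏ l : Fin n, sg (x i - x (i.succAbove l)) = (-1) ^ (i : ℕ) * (-1) ^ n *
      SS (fun l => x (i.succAbove l)) := by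
  rw [SS_above x i]
  have : (∏ l : Fin n, sg (x (i.succAbove l) - x i)) * ∏ l : Fin n, sg (x i - x (i.succAbove l))
      = (-1) ^ n := by
    rw [← Finset.prod_mul_distrib]
    rw [Finset.prod_congr rfl (g := fun _ => (-1 : ℝ))]
    · simp
    · intro l _
      rw [sg_swap (x i), mul_neg, sg_sq]
      rw [sub_ne_zero]
      exact fun h => Fin.succAbove_ne i l (hx h)
  linear_combination (-1) ^ (i : ℕ) * SS (fun l => x (i.succAbove l)) * this

lemma sum_finset (A : Finset ℝ) :
    ∑ a ∈ A, ∏ b ∈ A.erase a, sg (a - b) = if Odd A.card then 1 else 0 := by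
  induction A using Finset.induction_on_max with
  | empty => simp
  | insert M s hM ih =>
    have hn : M ∉ s := fun h => lt_irrefl _ (hM M h)
    rw [Finset.sum_insert hn, Finset.erase_insert hn, Finset.card_insert_of_notMem hn]
    rw [Finset.prod_congr rfl (g := fun _ => (1 : ℝ)) (fun b hb => sg_pos (sub_pos.2 (hM b hb)))]
    have : ∑ a ∈ s, ∏ b ∈ (insert M s).erase a, sg (a - b)
        = ∑ a ∈ s, -∏ b ∈ s.erase a, sg (a - b) := by
      apply Finset.sum_congr rfl
      intro a ha
      have hne : M ≠ a := fun h => hn (h ▸ ha)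
      rw [Finset.erase_insert_of_ne hne, Finset.prod_insert, sg_neg (sub_neg.2 (hM a ha))]
      · ring
      · simp [hn]
    rw [this, Finset.sum_neg_distrib, ih]
    by_cases h : Odd s.card
    · have h2 : ¬ Odd (s.card + 1) := by rw [Nat.odd_add_one]; simpa using h
      rw [if_pos h, if_neg h2]; simp
    · have h2 : Odd (s.card + 1) := by rw [Nat.odd_add_one]; exact h
      rw [if_neg h, if_pos h2]; simp

lemma sum_fin {n : ℕ} (x : Fin (n+1) → ℝ) (hx : Function.Injective x) :
    ∑ i, ∏ l : Fin n, sg (x i - x (i.succAbove l)) = if Even n then 1 else 0 := by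
  have h := sum_finset (Finset.univ.map ⟨x, hx⟩)
  rw [Finset.card_map, Finset.card_univ, Fintype.card_fin, Finset.sum_map] at h
  simp only [Nat.odd_add_one, Nat.not_odd_iff_even] at h
  rw [← h]
  apply Finset.sum_congr rfl
  intro i _
  have : (Finset.univ.map ⟨x, hx⟩).erase (x i)
      = (Finset.univ : Finset (Fin n)).map ((Fin.succAboveEmb i).trans ⟨x, hx⟩) := by
    ext b
    simp only [Finset.mem_erase, Finset.mem_map, Finset.mem_univ, true_and,
      Function.Embedding.coeFn_mk, Function.Embedding.trans_apply, Fin.coe_succAboveEmb]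
    constructor
    · rintro ⟨hb, j, rfl⟩
      obtain ⟨l, hl⟩ := Fin.exists_succAbove_eq (x := j) (y := i) (fun h => hb (by rw [h]))
      exact ⟨l, by rw [hl]⟩
    · rintro ⟨l, rfl⟩
      exact ⟨fun h => Fin.succAbove_ne i l (hx h), _, rfl⟩
  simp only [Function.Embedding.coeFn_mk]
  rw [this, Finset.prod_map]
  rfl

lemma SS_odd {n : ℕ} (hn : Even n) (x : Fin (n+1) → ℝ) (hx : Function.Injective x) :
    SS x = ∑ i : Fin (n+1), (-1) ^ (i : ℕ) * SS (fun l => x (i.succAbove l)) := by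
  have h := sum_fin x hx
  rw [if_pos hn] at h
  calc SS x = SS x * ∑ i, ∏ l : Fin n, sg (x i - x (i.succAbove l)) := by rw [h, mul_one]
    _ = _ := by
      rw [Finset.mul_sum]
      apply Finset.sum_congr rfl
      intro i _
      rw [SS_above' x hx, hn.neg_one_pow, mul_one]

lemma SS_even {n : ℕ} (hn : Even n) (x : Fin (n+2) → ℝ) (hx : Function.Injective x) :
    SS x = ∑ i : Fin (n+1), (-1) ^ (i : ℕ) * sg (x i.succ - x 0) *
      SS (fun l => x (i.succAbove l).succ) := by
  have h := sum_fin x hx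
  rw [if_neg (by rw [Nat.even_add_one]; simpa using hn), Fin.sum_univ_succ] at h
  simp only [Fin.zero_succAbove, Fin.prod_univ_succ (n := n), Fin.succ_succAbove_zero,
    Fin.succ_succAbove_succ] at h
  rw [← Fin.prod_univ_succ (fun i : Fin (n+1) => sg (x 0 - x i.succ))] at h
  have h1 : ∏ i : Fin (n+1), sg (x 0 - x i.succ) = - ∏ i : Fin (n+1), sg (x i.succ - x 0) := by
    rw [Finset.prod_congr rfl (fun i _ => sg_swap (x 0) (x i.succ)), Finset.prod_neg]
    simp [hn.add_one.neg_one_pow]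
  rw [h1] at h
  rw [SS_cons]
  have h2 : ∏ i : Fin (n+1), sg (x i.succ - x 0) = ∑ i : Fin (n+1), sg (x i.succ - x 0) *
      ∏ l : Fin n, sg (x i.succ - x (i.succAbove l).succ) := by linarith
  rw [h2, Finset.sum_mul]
  apply Finset.sum_congr rfl
  intro i _
  have := SS_above' (fun l : Fin (n+1) => x l.succ)
    (fun a b hab => Fin.succ_injective _ (hx hab)) i
  rw [hn.neg_one_pow, mul_one] at this
  linear_combination sg (x i.succ - x 0) * this

noncomputable abbrev mu1 : Measure ℝ := volume.restrict (Set.Icc (-1 : ℝ) 1)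
noncomputable abbrev muN (n : ℕ) : Measure (Fin n → ℝ) := Measure.pi (fun _ => mu1)

noncomputable def KK {n : ℕ} (q : Fin n → ℝ → ℝ) : ℝ := ∫ x, (∏ i, q i (x i)) * SS x ∂(muN n)

lemma abs_SS_le {n : ℕ} (x : Fin n → ℝ) : |SS x| ≤ 1 := by
  rw [SS_eq]; exact abs_sg_le _

lemma measurable_SS {n : ℕ} : Measurable (SS : (Fin n → ℝ) → ℝ) := by
  unfold SS
  refine Finset.measurable_prod _ fun i _ => Finset.measurable_prod _ fun j _ => ?_
  exact measurable_sg.comp ((measurable_pi_apply j).sub (measurable_pi_apply i))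

lemma integrable_one {q : ℝ → ℝ} (hq : Continuous q) : Integrable q mu1 :=
  hq.continuousOn.integrableOn_compact isCompact_Icc

lemma integrable_prod_mul {n : ℕ} {q : Fin n → ℝ → ℝ} (hq : ∀ i, Continuous (q i))
    {f : (Fin n → ℝ) → ℝ} (hf : Measurable f) (hb : ∀ x, |f x| ≤ 1) :
    Integrable (fun x => (∏ i, q i (x i)) * f x) (muN n) :=
  Integrable.mul_bdd (c := 1) (Integrable.fintype_prod fun i => integrable_one (hq i))
    hf.aestronglyMeasurable (Filter.Eventually.of_forall hb)

lemma mp (n : ℕ) (i : Fin (n+1)) : MeasurePreserving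
    (MeasurableEquiv.piFinSuccAbove (fun _ => ℝ) i) (muN (n+1)) (mu1.prod (muN n)) :=
  measurePreserving_piFinSuccAbove (fun _ => mu1) i

lemma integral_split {n : ℕ} (i : Fin (n+1)) (g : ℝ × (Fin n → ℝ) → ℝ) :
    ∫ x, g (x i, fun l => x (i.succAbove l)) ∂(muN (n+1)) = ∫ z, g z ∂(mu1.prod (muN n)) :=
  (mp n i).integral_comp' g

lemma ae_inj (n : ℕ) : ∀ᵐ x ∂(muN n), Function.Injective x := by
  have : ∀ i j : Fin n, i ≠ j → ∀ᵐ x ∂(muN n), x i ≠ x j := by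
    intro i j hij
    have h0 : (volume : Measure (Fin n → ℝ)) {x | x i = x j} = 0 := by
      let φ : (Fin n → ℝ) →ₗ[ℝ] ℝ := LinearMap.proj (R := ℝ) (φ := fun _ : Fin n => ℝ) i -
        LinearMap.proj (R := ℝ) (φ := fun _ : Fin n => ℝ) j
      have h1 : {x : Fin n → ℝ | x i = x j} = (LinearMap.ker φ : Set (Fin n → ℝ)) := by
        ext x; simp [φ, sub_eq_zero]
      rw [h1]
      apply Measure.addHaar_submodule
      intro h
      have : (Pi.single i 1 : Fin n → ℝ) ∈ LinearMap.ker φ := by rw [h]; trivial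
      simp [φ, hij, Pi.single_apply, hij.symm] at this
    have h2 : muN n = (volume : Measure (Fin n → ℝ)).restrict
        (Set.univ.pi fun _ => Set.Icc (-1 : ℝ) 1) := by
      rw [volume_pi, Measure.restrict_pi_pi]
    rw [h2]
    apply ae_restrict_of_ae
    rw [ae_iff]
    simpa using h0
  have h : ∀ᵐ x ∂(muN n), ∀ i j : Fin n, i ≠ j → x i ≠ x j := by
    rw [ae_all_iff]; intro i; rw [ae_all_iff]; intro j
    by_cases hij : i = j
    · simp [hij]
    · filter_upwards [this i j hij] with x hx _ using hx
  filter_upwards [h] with x hx i j hij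
  by_contra hne
  exact hx i j hne hij

lemma KK_odd {n : ℕ} (hn : Even n) (q : Fin (n+1) → ℝ → ℝ) (hq : ∀ i, Continuous (q i)) :
    KK q = ∑ i : Fin (n+1), (-1) ^ (i : ℕ) * (∫ t, q i t ∂mu1) *
      KK (fun l => q (i.succAbove l)) := by
  have h1 : KK q = ∫ x, ∑ i : Fin (n+1), (-1) ^ (i : ℕ) * ((∏ i, q i (x i)) *
      SS (fun l => x (i.succAbove l))) ∂(muN (n+1)) := by
    apply integral_congr_ae
    filter_upwards [ae_inj (n+1)] with x hx
    rw [SS_odd hn x hx, Finset.mul_sum]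
    exact Finset.sum_congr rfl fun i _ => by ring
  rw [h1, integral_finsetSum]
  · apply Finset.sum_congr rfl
    intro i _
    rw [integral_const_mul, mul_assoc]
    congr 1
    have := integral_split i (fun z => q i z.1 * ((∏ l, q (i.succAbove l) (z.2 l)) * SS z.2))
    rw [integral_prod_mul (q i) (fun y : Fin n → ℝ => (∏ l, q (i.succAbove l) (y l)) * SS y)] at this
    unfold KK
    rw [← this]
    congr 1
    funext x
    rw [Fin.prod_univ_succAbove _ i, mul_assoc]
  · intro i _
    apply Integrable.const_mul
    apply integrable_prod_mul hq
    · exact measurable_SS.comp (measurable_pi_iff.2 fun l => measurable_pi_apply _)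
    · intro x; exact abs_SS_le _

lemma KK_even {n : ℕ} (hn : Even n) (q : Fin (n+2) → ℝ → ℝ) (hq : ∀ i, Continuous (q i)) :
    KK q = ∑ i : Fin (n+1), (-1) ^ (i : ℕ) *
      (∫ a, ∫ b, q 0 a * q i.succ b * sg (b - a) ∂mu1 ∂mu1) *
      KK (fun l => q (i.succAbove l).succ) := by
  have h1 : KK q = ∫ x, ∑ i : Fin (n+1), (-1) ^ (i : ℕ) * ((∏ i, q i (x i)) *
      (sg (x i.succ - x 0) * SS (fun l => x (i.succAbove l).succ))) ∂(muN (n+2)) := by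
    apply integral_congr_ae
    filter_upwards [ae_inj (n+2)] with x hx
    rw [SS_even hn x hx, Finset.mul_sum]
    exact Finset.sum_congr rfl fun i _ => by ring
  have hint : ∀ i : Fin (n+1), Integrable (fun x : Fin (n+2) → ℝ => (∏ i, q i (x i)) *
      (sg (x i.succ - x 0) * SS (fun l => x (i.succAbove l).succ))) (muN (n+2)) := by
    intro i
    apply integrable_prod_mul hq
    · exact (measurable_sg.comp (Measurable.sub (f := fun x : Fin (n+2) → ℝ => x i.succ)
        (g := fun x => x 0) (measurable_pi_apply _) (measurable_pi_apply _))).mul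
        (measurable_SS.comp (measurable_pi_iff.2 fun l => measurable_pi_apply _))
    · intro x
      rw [abs_mul]
      exact mul_le_one₀ (abs_sg_le _) (abs_nonneg _) (abs_SS_le _)
  rw [h1, integral_finsetSum _ fun i _ => (hint i).const_mul _]
  apply Finset.sum_congr rfl
  intro i _
  rw [integral_const_mul, mul_assoc]
  congr 1
  let G : ℝ × (Fin (n+1) → ℝ) → ℝ := fun z => q 0 z.1 * (∏ l, q l.succ (z.2 l)) *
      (sg (z.2 i - z.1) * SS (fun l => z.2 (i.succAbove l)))
  have hG : ∀ x : Fin (n+2) → ℝ, (∏ i, q i (x i)) *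
      (sg (x i.succ - x 0) * SS (fun l => x (i.succAbove l).succ))
      = G (x 0, fun l => x ((0 : Fin (n+2)).succAbove l)) := by
    intro x
    simp only [G, Fin.zero_succAbove]
    rw [Fin.prod_univ_succ]
  have hGi : Integrable G (mu1.prod (muN (n+1))) := by
    rw [← (mp (n+1) 0).integrable_comp_emb (MeasurableEquiv.measurableEmbedding _)]
    refine (hint i).congr (Filter.Eventually.of_forall fun x => ?_)
    exact hG x
  simp only [hG]
  rw [integral_split 0 G, integral_prod _ hGi, ← integral_mul_const]
  congr 1
  funext a
  have := integral_split i (fun z => (q 0 a * q i.succ z.1 * sg (z.1 - a)) *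
    ((∏ l, q (i.succAbove l).succ (z.2 l)) * SS z.2))
  rw [integral_prod_mul (fun b => q 0 a * q i.succ b * sg (b - a))
    (fun y : Fin n → ℝ => (∏ l, q (i.succAbove l).succ (y l)) * SS y)] at this
  unfold KK
  rw [← this]
  congr 1
  funext x
  simp only [G]
  rw [Fin.prod_univ_succAbove _ i]
  ring

lemma cube_eq {n : ℕ} (q : Fin n → ℝ → ℝ) (hq : ∀ i, Continuous (q i))
    (hdet : ∀ x : Fin n → ℝ, (Matrix.of fun i j => q j (x i)).det = (Matrix.vandermonde x).det) :
    ∫ x in Set.univ.pi (fun _ : Fin n => Set.Icc (-1 : ℝ) 1),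
        ∏ i, ∏ j ∈ Finset.Ioi i, |x i - x j| = n.factorial * KK q := by
  have h2 : (volume : Measure (Fin n → ℝ)).restrict
      (Set.univ.pi fun _ => Set.Icc (-1 : ℝ) 1) = muN n := by
    rw [volume_pi, Measure.restrict_pi_pi]
  rw [h2]
  have h3 : ∀ x : Fin n → ℝ, ∏ i, ∏ j ∈ Finset.Ioi i, |x i - x j| =
      ∑ σ : Equiv.Perm (Fin n), (∏ i, q i (x (σ i))) * SS (fun i => x (σ i)) := by
    intro x
    have : ∏ i, ∏ j ∈ Finset.Ioi i, |x i - x j| = (Matrix.vandermonde x).det * SS x := by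
      rw [SS_eq, sg_mul_self_abs, Matrix.det_vandermonde, Finset.abs_prod]
      refine Finset.prod_congr rfl fun i _ => ?_
      rw [Finset.abs_prod]
      exact Finset.prod_congr rfl fun j _ => abs_sub_comm _ _
    rw [this, ← hdet, Matrix.det_apply', Finset.sum_mul]
    refine Finset.sum_congr rfl fun σ _ => ?_
    rw [SS_perm]
    simp only [Matrix.of_apply]
    ring
  simp only [h3]
  have hmp : ∀ σ : Equiv.Perm (Fin n), MeasurePreserving
      (MeasurableEquiv.piCongrLeft (fun _ => ℝ) σ.symm) (muN n) (muN n) :=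
    fun σ => measurePreserving_piCongrLeft (fun _ => mu1) σ.symm
  have hval : ∀ (σ : Equiv.Perm (Fin n)) (x : Fin n → ℝ),
      MeasurableEquiv.piCongrLeft (fun _ => ℝ) σ.symm x = fun i => x (σ i) := by
    intro σ x
    funext i
    have := Equiv.piCongrLeft_apply_apply (fun _ : Fin n => ℝ) σ.symm x (σ i)
    rw [Equiv.symm_apply_apply] at this
    exact this
  have hb : Integrable (fun x => (∏ i, q i (x i)) * SS x) (muN n) :=
    integrable_prod_mul hq measurable_SS abs_SS_le
  rw [integral_finsetSum]
  · have : ∀ σ : Equiv.Perm (Fin n),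
        ∫ x, (∏ i, q i (x (σ i))) * SS (fun i => x (σ i)) ∂(muN n) = KK q := by
      intro σ
      have := (hmp σ).integral_comp' (fun x => (∏ i, q i (x i)) * SS x)
      simp only [hval] at this
      exact this
    simp [this, Fintype.card_perm]
  · intro σ _
    have := ((hmp σ).integrable_comp_emb (MeasurableEquiv.measurableEmbedding _)).2 hb
    refine this.congr (Filter.Eventually.of_forall fun x => ?_)
    simp only [Function.comp, hval]

open Polynomial in
noncomputable def II (f : ℝ[X]) : ℝ := ∫ t, f.eval t ∂mu1

open Polynomial in
lemma II_eq (f : ℝ[X]) : II f = ∫ t in (-1 : ℝ)..1, f.eval t := by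
  rw [II, intervalIntegral.integral_of_le (by norm_num), integral_Icc_eq_integral_Ioc]

open Polynomial in
lemma ftc (f : ℝ[X]) (a b : ℝ) : ∫ t in a..b, (derivative f).eval t = f.eval b - f.eval a :=
  intervalIntegral.integral_eq_sub_of_hasDerivAt (fun x _ => f.hasDerivAt x)
    ((Polynomial.continuous _).intervalIntegrable _ _)

open Polynomial in
lemma II_deriv (f : ℝ[X]) : II (derivative f) = f.eval 1 - f.eval (-1) := by
  rw [II_eq, ftc]

open Polynomial in
lemma II_add (f g : ℝ[X]) : II (f + g) = II f + II g := by
  simp only [II, eval_add]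
  exact integral_add (integrable_one f.continuous) (integrable_one g.continuous)

open Polynomial in
lemma II_C_mul (c : ℝ) (f : ℝ[X]) : II (C c * f) = c * II f := by
  simp only [II, eval_mul, eval_C]
  exact integral_const_mul _ _

open Polynomial in
lemma II_ibp (q g : ℝ[X]) (h1 : g.eval 1 = 0) (h2 : g.eval (-1) = 0) :
    II (q * derivative g) = - II (derivative q * g) := by
  have := II_deriv (q * g)
  rw [derivative_mul, II_add] at this
  simp only [eval_mul, h1, h2] at this
  linarith

open Polynomial in
lemma bdry (n k : ℕ) (hk : k < n) (t : ℝ) (ht : t ^ 2 = 1) :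
    (derivative^[k] ((X ^ 2 - 1 : ℝ[X]) ^ n)).eval t = 0 := by
  obtain ⟨r, hr⟩ := pow_sub_dvd_iterate_derivative_pow (X ^ 2 - 1 : ℝ[X]) n k
  rw [hr]
  simp [ht, Nat.sub_ne_zero_of_lt hk]

open Polynomial in
lemma II_iter (n k : ℕ) (hk : k ≤ n) (q : ℝ[X]) :
    II (q * derivative^[k] ((X ^ 2 - 1 : ℝ[X]) ^ n)) =
      (-1) ^ k * II (derivative^[k] q * (X ^ 2 - 1 : ℝ[X]) ^ n) := by
  induction k generalizing q with
  | zero => simp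
  | succ k ih =>
    rw [Function.iterate_succ_apply', II_ibp _ _ (bdry n k hk 1 (by norm_num))
      (bdry n k hk (-1) (by norm_num)), ih (by omega), ← Function.iterate_succ_apply]
    ring

open Polynomial in
noncomputable def WW (n : ℕ) : ℝ := II ((1 - X ^ 2) ^ n)

open Polynomial in
lemma WW_zero : WW 0 = 2 := by
  have := II_deriv X
  simp at this
  simp [WW, this]; norm_num

open Polynomial in
lemma WW_succ (n : ℕ) : (2 * n + 3) * WW (n+1) = (2 * n + 2) * WW n := by
  have h := II_deriv (X * (1 - X ^ 2) ^ (n+1))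
  have h2 : derivative (X * (1 - X ^ 2) ^ (n+1) : ℝ[X]) =
      C (2 * n + 3 : ℝ) * (1 - X ^ 2) ^ (n+1) + C (-(2 * n + 2) : ℝ) * (1 - X ^ 2) ^ n := by
    rw [derivative_mul, derivative_pow]
    have c2 : (C 2 : ℝ[X]) = 2 := map_ofNat C 2
    have c3 : (C 3 : ℝ[X]) = 3 := map_ofNat C 3
    simp [c2, c3]
    ring
  rw [h2, II_add, II_C_mul, II_C_mul] at h
  simp at h
  unfold WW
  linarith

lemma WW_eq (n : ℕ) : WW n = 2 ^ (2 * n + 1) * (n.factorial : ℝ) ^ 2 / (2 * n + 1).factorial := by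
  induction n with
  | zero => simp [WW_zero]
  | succ n ih =>
    have h := WW_succ n
    rw [ih] at h
    have h3 : (2 * n + 3 : ℝ) ≠ 0 := by positivity
    have e : (2 * (n + 1) + 1).factorial = (2 * n + 3) * ((2 * n + 2) * (2 * n + 1).factorial) := by
      rw [show 2 * (n+1) + 1 = (2 * n + 1) + 1 + 1 by ring, Nat.factorial_succ, Nat.factorial_succ]
    have hf : ((2 * n + 1).factorial : ℝ) ≠ 0 := by positivity
    apply mul_left_cancel₀ h3
    rw [h, e, Nat.factorial_succ n]
    push_cast
    field_simp
    ring

open Polynomial in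
noncomputable def pl (n : ℕ) : ℝ[X] :=
  C ((n.factorial : ℝ) / (2 * n).factorial) * derivative^[n] ((X ^ 2 - 1 : ℝ[X]) ^ n)

open Polynomial in
lemma base_monic : (X ^ 2 - 1 : ℝ[X]).Monic := by
  simpa using monic_X_pow_sub_C (1 : ℝ) (two_ne_zero)

open Polynomial in
lemma base_deg (n : ℕ) : ((X ^ 2 - 1 : ℝ[X]) ^ n).natDegree = 2 * n := by
  rw [natDegree_pow]
  have : (X ^ 2 - 1 : ℝ[X]).natDegree = 2 := by
    simpa using natDegree_X_pow_sub_C (n := 2) (r := (1 : ℝ))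
  rw [this]; ring

open Polynomial in
lemma pl_le (n : ℕ) : (pl n).natDegree ≤ n := by
  unfold pl
  refine (natDegree_C_mul_le _ _).trans ((natDegree_iterate_derivative _ _).trans ?_)
  rw [base_deg]; omega

open Polynomial in
lemma pl_coeff (n : ℕ) : (pl n).coeff n = 1 := by
  unfold pl
  rw [coeff_C_mul, coeff_iterate_derivative]
  have h : ((X ^ 2 - 1 : ℝ[X]) ^ n).coeff (n + n) = 1 := by
    have := base_monic.pow n
    rw [Monic, leadingCoeff, base_deg] at this
    rw [← two_mul]; exact this
  rw [h]
  have h2 := Nat.factorial_mul_descFactorial (Nat.le_add_left n n)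
  rw [Nat.add_sub_cancel] at h2
  have h3 : ((2 * n).factorial : ℝ) = n.factorial * ((n + n).descFactorial n : ℕ) := by
    rw [two_mul, ← h2]; push_cast; rfl
  have : (0 : ℝ) < (2 * n).factorial := by positivity
  simp only [nsmul_eq_mul, mul_one]
  rw [div_mul_eq_mul_div, ← h3, div_self this.ne']

open Polynomial in
lemma pl_deg (n : ℕ) : (pl n).natDegree = n :=
  le_antisymm (pl_le n) (le_natDegree_of_ne_zero (by rw [pl_coeff]; exact one_ne_zero))

open Polynomial in
lemma pl_monic (n : ℕ) : (pl n).Monic := by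
  rw [Monic, leadingCoeff, pl_deg, pl_coeff]

noncomputable def hh (n : ℕ) : ℝ := (n.factorial : ℝ) ^ 2 / (2 * n).factorial * WW n

open Polynomial in
lemma II_pl (n : ℕ) (q : ℝ[X]) (hq : q.natDegree ≤ n) : II (q * pl n) = q.coeff n * hh n := by
  have hD : derivative^[n] q = C (n.factorial * q.coeff n) := by
    ext m
    rw [coeff_iterate_derivative, coeff_C]
    split_ifs with hm
    · subst hm; simp [Nat.descFactorial_self]
    · rw [coeff_eq_zero_of_natDegree_lt (by omega)]; simp
  unfold pl
  rw [mul_left_comm, II_C_mul, II_iter n n le_rfl, hD, II_C_mul]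
  have : II ((X ^ 2 - 1 : ℝ[X]) ^ n) = (-1) ^ n * WW n := by
    rw [WW, ← II_C_mul]
    congr 1
    rw [C_pow, ← mul_pow]
    congr 1
    simp
  rw [this, hh]
  have h1 : ((-1 : ℝ) ^ n) * (-1) ^ n = 1 := by rw [← mul_pow]; simp
  linear_combination ((n.factorial : ℝ) / (2 * n).factorial * (n.factorial * q.coeff n) * WW n) * h1

open Polynomial in
lemma E1 (n : ℕ) : II (pl n) = if n = 0 then 2 else 0 := by
  have := II_pl n 1 (by simp)
  rw [one_mul] at this
  rw [this]
  split_ifs with h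
  · subst h; simp [hh, WW_zero]
  · rw [coeff_one, if_neg h, zero_mul]

open Polynomial in
lemma inner_int (Q : ℝ[X]) (a : ℝ) (ha : a ∈ Set.Icc (-1 : ℝ) 1) :
    ∫ b, (derivative Q).eval b * sg (b - a) ∂mu1 = Q.eval 1 + Q.eval (-1) - 2 * Q.eval a := by
  have hc := (derivative Q).continuous
  have key : ∀ u v : ℝ, IntervalIntegrable (fun b => (derivative Q).eval b * sg (b - a))
      volume u v := by
    intro u v
    rw [intervalIntegrable_iff]
    refine Integrable.mul_bdd (c := 1) ((hc.intervalIntegrable u v).def') ?_ ?_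
    · exact (measurable_sg.comp (measurable_id.sub_const a)).aestronglyMeasurable
    · exact Filter.Eventually.of_forall fun x => abs_sg_le _
  rw [integral_Icc_eq_integral_Ioc, ← intervalIntegral.integral_of_le (by norm_num),
    ← intervalIntegral.integral_add_adjacent_intervals (key (-1) a) (key a 1)]
  have h1 : ∫ b in (-1 : ℝ)..a, (derivative Q).eval b * sg (b - a)
      = ∫ b in (-1 : ℝ)..a, -(derivative Q).eval b := by
    rw [intervalIntegral.integral_of_le ha.1, intervalIntegral.integral_of_le ha.1,
      integral_Ioc_eq_integral_Ioo, integral_Ioc_eq_integral_Ioo]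
    refine setIntegral_congr_fun measurableSet_Ioo fun b hb => ?_
    simp only [sg_neg (sub_neg.2 hb.2)]
    ring
  have h2 : ∫ b in a..1, (derivative Q).eval b * sg (b - a)
      = ∫ b in a..1, (derivative Q).eval b := by
    rw [intervalIntegral.integral_of_le ha.2, intervalIntegral.integral_of_le ha.2]
    refine setIntegral_congr_fun measurableSet_Ioc fun b hb => ?_
    simp only [sg_pos (sub_pos.2 hb.1)]
    ring
  rw [h1, h2, intervalIntegral.integral_neg, ftc, ftc]
  ring

open Polynomial in
lemma E2_aux (P Q : ℝ[X]) (h1 : Q.eval 1 = 0) (h2 : Q.eval (-1) = 0) :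
    ∫ a, ∫ b, (derivative P).eval a * (derivative Q).eval b * sg (b - a) ∂mu1 ∂mu1
      = 2 * II (P * derivative Q) := by
  have : ∫ a, ∫ b, (derivative P).eval a * (derivative Q).eval b * sg (b - a) ∂mu1 ∂mu1
      = ∫ a, (C (-2) * (derivative P * Q)).eval a ∂mu1 := by
    refine setIntegral_congr_fun measurableSet_Icc fun a ha => ?_
    simp only [mul_assoc]
    rw [integral_const_mul, inner_int Q a ha, h1, h2]
    simp
    ring
  rw [this, ← II, II_C_mul, II_ibp _ _ h1 h2]
  ring

open Polynomial in
lemma exists_anti (p : ℝ[X]) : ∃ P : ℝ[X], derivative P = p ∧ P.natDegree ≤ p.natDegree + 1 := by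
  refine ⟨∑ i ∈ Finset.range (p.natDegree + 1), C (p.coeff i / (i + 1)) * X ^ (i + 1), ?_, ?_⟩
  · rw [derivative_sum]
    conv_rhs => rw [p.as_sum_range_C_mul_X_pow]
    refine Finset.sum_congr rfl fun i _ => ?_
    rw [derivative_C_mul_X_pow]
    have : (i + 1 : ℝ) ≠ 0 := by positivity
    simp
    rw [← C_1, ← C_eq_natCast, ← C_add, ← C_mul]
    congr 1
    field_simp
  · refine natDegree_sum_le_of_forall_le _ _ fun i hi => ?_
    refine (natDegree_C_mul_X_pow_le _ _).trans ?_
    have := Finset.mem_range.1 hi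
    omega

open Polynomial in
lemma E2 (s n : ℕ) (h : s < n) :
    ∫ a, ∫ b, (pl s).eval a * (pl n).eval b * sg (b - a) ∂mu1 ∂mu1
      = if n = s + 1 then 2 / (s + 1) * hh (s + 1) else 0 := by
  obtain ⟨P, hP, hPd⟩ := exists_anti (pl s)
  rw [pl_deg] at hPd
  obtain ⟨k, rfl⟩ : ∃ k, n = k + 1 := ⟨n - 1, by omega⟩
  have hQ : derivative (C (((k+1).factorial : ℝ) / (2 * (k+1)).factorial) *
      derivative^[k] ((X ^ 2 - 1 : ℝ[X]) ^ (k+1))) = pl (k+1) := by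
    rw [derivative_C_mul, ← Function.iterate_succ_apply' (f := derivative), pl]
  rw [← hP, ← hQ, E2_aux]
  · rw [hQ, II_pl _ _ (by omega)]
    split_ifs with hk
    · rw [hk]
      have := pl_coeff s
      rw [← hP, coeff_derivative] at this
      have h0 : (s + 1 : ℝ) ≠ 0 := by positivity
      rw [eq_div_of_mul_eq h0 this]
      ring
    · rw [coeff_eq_zero_of_natDegree_lt (by omega)]; ring
  · simp [bdry (k+1) k (by omega) 1 (by norm_num)]
  · simp [bdry (k+1) k (by omega) (-1) (by norm_num)]

noncomputable def KP (s n : ℕ) : ℝ := KK (fun i : Fin n => fun t => (pl (s + i)).eval t)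

lemma KP_zero (s : ℕ) : KP s 0 = 1 := by
  simp [KP, KK, SS, Measure.real]

lemma KP_even (s n : ℕ) (hn : Even n) :
    KP s (n + 2) = 2 / (s + 1) * hh (s + 1) * KP (s + 2) n := by
  unfold KP
  rw [KK_even hn _ fun i => Polynomial.continuous _, Finset.sum_eq_single 0]
  · have := E2 s (s + 1) (by omega)
    simp only [Fin.val_zero, pow_zero, one_mul, Fin.val_succ, add_zero, zero_add,
      Fin.zero_succAbove]
    rw [this, if_pos rfl]
    congr 2
    funext i t
    rw [show s + (i.val + 1 + 1) = s + 2 + i.val by ring]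
  · intro i _ hi
    have hi' : (i : ℕ) ≠ 0 := fun h => hi (Fin.ext h)
    have := E2 s (s + (i + 1)) (by omega)
    rw [if_neg (by omega)] at this
    simp only [Fin.val_zero, Fin.val_succ, add_zero]
    rw [this]; ring
  · simp

lemma KP_odd (n : ℕ) (hn : Even n) : KP 0 (n + 1) = 2 * KP 1 n := by
  unfold KP
  rw [KK_odd hn _ fun i => Polynomial.continuous _, Finset.sum_eq_single 0]
  · have := E1 0
    rw [if_pos rfl, II] at this
    simp only [Fin.val_zero, pow_zero, one_mul, Fin.val_succ, add_zero,
      Fin.zero_succAbove]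
    rw [this]
    congr 2
    funext i t
    rw [show 0 + (i.val + 1) = 1 + i.val by ring]
  · intro i _ hi
    have hi' : (i : ℕ) ≠ 0 := fun h => hi (Fin.ext h)
    have := E1 (0 + i)
    rw [if_neg (by omega), II] at this
    rw [this]; ring
  · simp

lemma KP_prod (s k : ℕ) : KP s (2 * k) =
    ∏ i ∈ Finset.range k, (2 / ((s + 2 * i : ℕ) + 1 : ℝ) * hh (s + 2 * i + 1)) := by
  induction k generalizing s with
  | zero => simp [KP_zero]
  | succ k ih =>
    rw [show 2 * (k + 1) = 2 * k + 2 by ring, KP_even s _ (even_two_mul k), ih,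
      Finset.prod_range_succ', mul_comm]
    congr 1
    refine Finset.prod_congr rfl fun i _ => ?_
    rw [show s + 2 * (i + 1) = s + 2 + 2 * i by ring]

noncomputable def TT (m : ℕ) : ℝ := 2 ^ (m * (m + 1) / 2) *
  ∏ k ∈ Finset.range m, ((k.factorial : ℝ)) ^ 2 / ((2 * k + 1).factorial : ℝ)

lemma TT_step (m : ℕ) : TT (m + 2) = TT m * (2 / ((m : ℕ) + 1 : ℝ) * hh (m + 1)) := by
  unfold TT hh
  rw [Finset.prod_range_succ, Finset.prod_range_succ, WW_eq]
  have e1 : (m + 2) * (m + 2 + 1) / 2 = m * (m + 1) / 2 + (2 * m + 3) := by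
    rw [show (m + 2) * (m + 2 + 1) = m * (m + 1) + (2 * m + 3) * 2 by ring,
      Nat.add_mul_div_right _ _ two_pos]
  have e2 : (2 * (m + 1)).factorial = (2 * m + 2) * (2 * m + 1).factorial := by
    rw [show 2 * (m + 1) = 2 * m + 1 + 1 by ring, Nat.factorial_succ]
  rw [e1, pow_add, e2, Nat.factorial_succ m, show 2 * (m + 1) + 1 = 2 * m + 3 by ring]
  push_cast
  have h1 : ((2 * m + 1).factorial : ℝ) ≠ 0 := by positivity
  have h2 : ((2 * m + 3).factorial : ℝ) ≠ 0 := by positivity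
  have h3 : (m + 1 : ℝ) ≠ 0 := by positivity
  have h4 : (2 * m + 2 : ℝ) ≠ 0 := by positivity
  field_simp

lemma KP_eq (m : ℕ) : KP 0 m = TT m := by
  rcases Nat.even_or_odd' m with ⟨k, rfl | rfl⟩
  · rw [KP_prod]
    induction k with
    | zero => simp [TT]
    | succ k ih =>
      rw [Finset.prod_range_succ, ih, show 2 * (k + 1) = 2 * k + 2 by ring, TT_step, zero_add]
  · rw [KP_odd _ (even_two_mul k), KP_prod]
    induction k with
    | zero => simp [TT]
    | succ k ih =>
      rw [Finset.prod_range_succ, ← mul_assoc, ih,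
        show 2 * (k + 1) + 1 = 2 * k + 1 + 2 by ring, TT_step, add_comm 1 (2 * k)]

theorem selberg_symmetric_cube (m : ℕ) (hm : 1 ≤ m) :
    (∫ x in Set.univ.pi (fun _ : Fin m => Set.Icc (-1 : ℝ) 1),
        ∏ i, ∏ j ∈ Finset.Ioi i, |x i - x j|)
      = 2 ^ (m * (m + 1) / 2) * (m.factorial : ℝ) *
          ∏ k ∈ Finset.range m, ((k.factorial : ℝ)) ^ 2 / ((2 * k + 1).factorial : ℝ) := by
  have h := cube_eq (fun i : Fin m => fun t => (pl (0 + i)).eval t)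
    (fun i => Polynomial.continuous _) (fun x => by
      rw [Matrix.det_eval_matrixOfPolynomials_eq_det_vandermonde x (fun i => pl (0 + i))
        (fun i => by rw [pl_deg, zero_add]) (fun i => pl_monic _)])
  rw [h, ← KP, KP_eq, TT]
  ring
end
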